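/- arXiv:1506.00949 — 2 statements merged into one kernel-verified Lean document; each statement's English description precedes it below -/
import Mathlib

section
/- Let Γ be a recursive game with {v_n : n ≥ 1} totally bounded for the uniform norm, and let f be a limit point of (v_n) in (B(X), ‖·‖_∞). Then for every state x₁ ∈ X, the one-shot game G^f at x₁ has value f(x₁): sup_{s ∈ Δ(A(x₁))} inf_{t ∈ Δ(B(x₁))} E_{q(x₁,s,t)}[f(x₂)] = inf_{t ∈ Δ(B(x₁))} sup_{s ∈ Δ(A(x₁))} E_{q(x₁,s,t)}[f(x₂)] = f(x₁). -/
open scoped Classical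
open Filter

noncomputable section

/-- A two-player zero-sum stochastic game: a state space `X`, action sets `A`, `B`
with a nonempty finite feasible subset at every state, a payoff function with values
in `[-1,1]`, and a finitely supported transition probability function. -/
structure StocGame where
  X : Type
  A : Type
  B : Type
  actA : X → Finset A
  actB : X → Finset B
  actA_nonempty : ∀ x, (actA x).Nonempty
  actB_nonempty : ∀ x, (actB x).Nonempty
  g : X → A → B → ℝ
  g_bdd : ∀ x a b, |g x a b| ≤ 1
  q : X → A → B → X → ℝ
  q_nonneg : ∀ x a b y, 0 ≤ q x a b y
  q_finsupp : ∀ x a b, (Function.support (q x a b)).Finite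
  q_sum : ∀ x a b, (∑' y, q x a b y) = 1

namespace StocGame

variable (G : StocGame)

/-- A behavior strategy of player 1: to every past history (a chronological list of
(state, action of player 1, action of player 2) triples) and every current state, it
assigns a mixed action supported on the feasible action set. -/
structure Strategy1 where
  play : List (G.X × G.A × G.B) → G.X → G.A → ℝ
  nonneg : ∀ h x a, 0 ≤ play h x a
  supp : ∀ h x a, a ∉ G.actA x → play h x a = 0
  sum_one : ∀ h x, ∑ a ∈ G.actA x, play h x a = 1

/-- A behavior strategy of player 2. -/
structure Strategy2 where
  play : List (G.X × G.A × G.B) → G.X → G.B → ℝ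
  nonneg : ∀ h x b, 0 ≤ play h x b
  supp : ∀ h x b, b ∉ G.actB x → play h x b = 0
  sum_one : ∀ h x, ∑ b ∈ G.actB x, play h x b = 1

variable {G}

/-- The chronological sequence of states visited along a finite history
(past history together with the current state). -/
def stateSeq (hx : List (G.X × G.A × G.B) × G.X) : List G.X :=
  hx.1.map Prod.fst ++ [hx.2]

/-- A strategy of player 1 which depends on the history only through the sequence of
visited states (and not on past actions). -/
def Strategy1.stateDep (σ : Strategy1 G) : Prop :=
  ∀ h h' x, h.map Prod.fst = h'.map Prod.fst → σ.play h x = σ.play h' x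

/-- A strategy of player 2 which depends on the history only through the sequence of
visited states (and not on past actions). -/
def Strategy2.stateDep (τ : Strategy2 G) : Prop :=
  ∀ h h' x, h.map Prod.fst = h'.map Prod.fst → τ.play h x = τ.play h' x

/-- A pure strategy of player 1. -/
def Strategy1.pure (σ : Strategy1 G) : Prop :=
  ∀ h x, ∃ a ∈ G.actA x, σ.play h x a = 1

/-- A pure strategy of player 2. -/
def Strategy2.pure (τ : Strategy2 G) : Prop :=
  ∀ h x, ∃ b ∈ G.actB x, τ.play h x b = 1

variable (G)

/-- Auxiliary function: the probability of a finite history, the past history being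
given in reverse chronological order. -/
def histProbAux (x₁ : G.X) (σ : Strategy1 G) (τ : Strategy2 G) :
    List (G.X × G.A × G.B) → G.X → ℝ
  | [], x => if x = x₁ then 1 else 0
  | (y, a, b) :: rest, x =>
      histProbAux x₁ σ τ rest y * σ.play rest.reverse y a * τ.play rest.reverse y b *
        G.q y a b x

/-- Probability, in the game starting at `x₁` played with `(σ, τ)`, that the play starts
with the (chronological) past history `h` followed by the current state `x`. -/
def histProb (x₁ : G.X) (σ : Strategy1 G) (τ : Strategy2 G)
    (h : List (G.X × G.A × G.B)) (x : G.X) : ℝ :=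
  G.histProbAux x₁ σ τ h.reverse x

/-- Expected payoff of stage `t` in the game starting at `x₁` played with `(σ, τ)`. -/
def stagePayoff (x₁ : G.X) (σ : Strategy1 G) (τ : Strategy2 G) (t : ℕ) : ℝ :=
  ∑' hx : List (G.X × G.A × G.B) × G.X,
    if hx.1.length + 1 = t then
      G.histProb x₁ σ τ hx.1 hx.2 *
        ∑ a ∈ G.actA hx.2, ∑ b ∈ G.actB hx.2,
          σ.play hx.1 hx.2 a * τ.play hx.1 hx.2 b * G.g hx.2 a b
    else 0

/-- Expected average payoff `γ_n(x₁, σ, τ)` over the `n` first stages. -/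
def avgPayoff (x₁ : G.X) (σ : Strategy1 G) (τ : Strategy2 G) (n : ℕ) : ℝ :=
  (n : ℝ)⁻¹ * ∑ t ∈ Finset.Icc 1 n, G.stagePayoff x₁ σ τ t

/-- Expected `λ`-discounted payoff `γ_λ(x₁, σ, τ)`. -/
def discPayoff (x₁ : G.X) (σ : Strategy1 G) (τ : Strategy2 G) (lam : ℝ) : ℝ :=
  ∑' t : ℕ, lam * (1 - lam) ^ t * G.stagePayoff x₁ σ τ (t + 1)

/-- The value `v_n(x₁)` of the `n`-stage game (by the minmax theorem, the game has a
value, which is then equal to this maxmin). -/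
def nValue (n : ℕ) (x₁ : G.X) : ℝ :=
  ⨆ σ : Strategy1 G, ⨅ τ : Strategy2 G, G.avgPayoff x₁ σ τ n

/-- The value `v_λ(x₁)` of the `λ`-discounted game. -/
def lamValue (lam : ℝ) (x₁ : G.X) : ℝ :=
  ⨆ σ : Strategy1 G, ⨅ τ : Strategy2 G, G.discPayoff x₁ σ τ lam

/-- The pointwise limit superior `v(x) = limsup_n v_n(x)` of the `n`-stage values. -/
def limsupV (x : G.X) : ℝ := Filter.limsup (fun n => G.nValue n x) Filter.atTop

/-- The family `{v_n, n ≥ 1}` is totally bounded for the uniform norm: for every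
`ε > 0` there is a finite subfamily within uniform distance `ε` of every member. -/
def TotallyBoundedValues : Prop :=
  ∀ ε > (0 : ℝ), ∃ S : Finset ℕ, (∀ m ∈ S, 1 ≤ m) ∧
    ∀ n, 1 ≤ n → ∃ m ∈ S, ∀ x, |G.nValue n x - G.nValue m x| ≤ ε

/-- Probability that the sequence of the first states of the play is `s`. -/
def statesProb (x₁ : G.X) (σ : Strategy1 G) (τ : Strategy2 G) (s : List G.X) : ℝ :=
  ∑' hx : List (G.X × G.A × G.B) × G.X,
    if stateSeq hx = s then G.histProb x₁ σ τ hx.1 hx.2 else 0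

end StocGame

/-- A two-player zero-sum recursive game: a stochastic game whose state space is
partitioned into active states (where the payoff is `0`) and absorbing states (which
are trapping, with a payoff depending only on the state). -/
structure RecGame extends StocGame where
  absorbing : X → Prop
  g_active : ∀ x a b, ¬ absorbing x → g x a b = 0
  absorbing_q : ∀ x a b, absorbing x → q x a b x = 1
  absorbing_g : ∀ x a b a' b', absorbing x → g x a b = g x a' b'

namespace RecGame

variable (G : RecGame)

/-- The stage payoff as a function of the state only: `0` on active states, and the
absorbing payoff on absorbing states. -/
def stateg (x : G.X) : ℝ :=
  G.g x (G.actA_nonempty x).choose (G.actB_nonempty x).choose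

/-- Probability that the play is absorbed within the first `N` stages; since absorbing
states are trapping this is the probability that the state of stage `N` is absorbing,
i.e. `P(ρ ≤ N)` where `ρ` is the absorption time. -/
def absorbedProb (x₁ : G.X) (σ : G.toStocGame.Strategy1) (τ : G.toStocGame.Strategy2)
    (N : ℕ) : ℝ :=
  ∑' hx : List (G.X × G.A × G.B) × G.X,
    if hx.1.length + 1 = N ∧ G.absorbing hx.2 then
      G.toStocGame.histProb x₁ σ τ hx.1 hx.2 else 0

/-- A uniformly terminating strategy of player 1. -/
def UniformlyTerminating1 (σ : G.toStocGame.Strategy1) : Prop :=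
  ∀ ε > (0 : ℝ), ∃ N : ℕ, 1 ≤ N ∧ ∀ x₁, ¬ G.absorbing x₁ →
    ∀ τ, G.absorbedProb x₁ σ τ N ≥ 1 - ε

end RecGame

namespace StocGame

/-- Mixed actions over a finite feasible set. -/
def Mixed {α : Type} (s : Finset α) : Type :=
  {p : α → ℝ // (∀ a, 0 ≤ p a) ∧ (∀ a ∉ s, p a = 0) ∧ ∑ a ∈ s, p a = 1}

/-- The payoff of the one-shot game `G^f` at `x₁`, for mixed actions `s, t`. -/
def oneShotPayoff (G : StocGame) (f : G.X → ℝ) (x₁ : G.X)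
    (s : Mixed (G.actA x₁)) (t : Mixed (G.actB x₁)) : ℝ :=
  ∑ a ∈ G.actA x₁, ∑ b ∈ G.actB x₁,
    s.1 a * t.1 b * ∑' y, G.q x₁ a b y * f y

end StocGame

namespace StocGame

section OneStep

variable {G : StocGame}

theorem Mixed.le_one {α : Type} {s : Finset α} (p : Mixed s) (a : α) : p.1 a ≤ 1 := by
  by_cases ha : a ∈ s
  · exact (Finset.single_le_sum (fun i _ => p.2.1 i) ha).trans_eq p.2.2.2
  · rw [p.2.2.1 a ha]
    exact zero_le_one

theorem Mixed.nonempty {α : Type} {s : Finset α} (hs : s.Nonempty) : Nonempty (Mixed s) := by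
  obtain ⟨a, ha⟩ := hs
  refine ⟨⟨fun i => if i = a then 1 else 0, fun i => by positivity, fun i hi => ?_, ?_⟩⟩
  · exact if_neg fun h => hi (by rwa [h])
  · simp [ha]

theorem tsum_q_mul_eq_sum (x : G.X) (a : G.A) (b : G.B) (F : G.X → ℝ) :
    ∑' y, G.q x a b y * F y = ∑ y ∈ (G.q_finsupp x a b).toFinset, G.q x a b y * F y := by
  refine tsum_eq_sum fun y hy => ?_
  rw [Set.Finite.mem_toFinset, Function.mem_support, not_not] at hy
  rw [hy, zero_mul]

theorem sum_support_q (x : G.X) (a : G.A) (b : G.B) :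
    ∑ y ∈ (G.q_finsupp x a b).toFinset, G.q x a b y = 1 := by
  have h := tsum_q_mul_eq_sum x a b (fun _ => 1)
  simp only [mul_one] at h
  rw [← h, G.q_sum]

variable (G) in
/-- Expectation of `F a b y` when the actions `a`, `b` at state `x` are drawn with weights
`s`, `t` and `y` is the next state. -/
def stepExp (x : G.X) (s : G.A → ℝ) (t : G.B → ℝ) (F : G.A → G.B → G.X → ℝ) : ℝ :=
  ∑ a ∈ G.actA x, ∑ b ∈ G.actB x, s a * t b * ∑' y, G.q x a b y * F a b y

theorem stepExp_mono {x : G.X} {s : G.A → ℝ} {t : G.B → ℝ} (hs : ∀ a, 0 ≤ s a)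
    (ht : ∀ b, 0 ≤ t b) {F F' : G.A → G.B → G.X → ℝ} (h : ∀ a b y, F a b y ≤ F' a b y) :
    G.stepExp x s t F ≤ G.stepExp x s t F' := by
  unfold stepExp
  simp only [tsum_q_mul_eq_sum]
  refine Finset.sum_le_sum fun a _ => Finset.sum_le_sum fun b _ =>
    mul_le_mul_of_nonneg_left (Finset.sum_le_sum fun y _ =>
      mul_le_mul_of_nonneg_left (h a b y) (G.q_nonneg x a b y)) (mul_nonneg (hs a) (ht b))

theorem stepExp_add (x : G.X) (s : G.A → ℝ) (t : G.B → ℝ) (F F' : G.A → G.B → G.X → ℝ) :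
    G.stepExp x s t (fun a b y => F a b y + F' a b y) =
      G.stepExp x s t F + G.stepExp x s t F' := by
  unfold stepExp
  simp_rw [tsum_q_mul_eq_sum, mul_add, Finset.sum_add_distrib, mul_add,
    Finset.sum_add_distrib]

theorem stepExp_const_mul (x : G.X) (s : G.A → ℝ) (t : G.B → ℝ) (c : ℝ)
    (F : G.A → G.B → G.X → ℝ) :
    G.stepExp x s t (fun a b y => c * F a b y) = c * G.stepExp x s t F := by
  unfold stepExp
  simp only [tsum_q_mul_eq_sum, Finset.mul_sum]
  refine Finset.sum_congr rfl fun a _ => Finset.sum_congr rfl fun b _ =>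
    Finset.sum_congr rfl fun y _ => ?_
  ring

theorem stepExp_const (x : G.X) {s : G.A → ℝ} {t : G.B → ℝ} (hs : ∑ a ∈ G.actA x, s a = 1)
    (ht : ∑ b ∈ G.actB x, t b = 1) (c : ℝ) : G.stepExp x s t (fun _ _ _ => c) = c := by
  unfold stepExp
  simp only [tsum_q_mul_eq_sum, ← Finset.sum_mul, sum_support_q, one_mul, ← Finset.mul_sum, ht,
    hs, mul_one]

theorem stepExp_add_const (x : G.X) {s : G.A → ℝ} {t : G.B → ℝ}
    (hs : ∑ a ∈ G.actA x, s a = 1) (ht : ∑ b ∈ G.actB x, t b = 1)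
    (F : G.A → G.B → G.X → ℝ) (c : ℝ) :
    G.stepExp x s t (fun a b y => F a b y + c) = G.stepExp x s t F + c := by
  rw [stepExp_add, stepExp_const x hs ht]

theorem stepExp_sum (x : G.X) (s : G.A → ℝ) (t : G.B → ℝ) {ι : Type} (I : Finset ι)
    (F : ι → G.A → G.B → G.X → ℝ) :
    G.stepExp x s t (fun a b y => ∑ i ∈ I, F i a b y) = ∑ i ∈ I, G.stepExp x s t (F i) := by
  induction I using Finset.induction_on with
  | empty => simp [stepExp]
  | insert i I hi ih => simp only [Finset.sum_insert hi, stepExp_add, ih]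

/-- The finite one-shot game has a saddle point in mixed actions. -/
theorem exists_saddlePoint_oneShotPayoff (f : G.X → ℝ) (x : G.X) :
    ∃ (s₀ : Mixed (G.actA x)) (t₀ : Mixed (G.actB x)), ∀ s t,
      G.oneShotPayoff f x s t₀ ≤ G.oneShotPayoff f x s₀ t := by
  have hconv : ∀ {α : Type} (S : Finset α),
      Convex ℝ {p : α → ℝ | (∀ a, 0 ≤ p a) ∧ (∀ a ∉ S, p a = 0) ∧ ∑ a ∈ S, p a = 1} := by
    intro α S p hp r hr c d hc hd hcd
    refine ⟨fun a => ?_, fun a ha => ?_, ?_⟩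
    · exact add_nonneg (mul_nonneg hc (hp.1 a)) (mul_nonneg hd (hr.1 a))
    · simp [hp.2.1 a ha, hr.2.1 a ha]
    · simp [Finset.sum_add_distrib, ← Finset.mul_sum, hp.2.2, hr.2.2, hcd]
  have hcomp : ∀ {α : Type} (S : Finset α),
      IsCompact {p : α → ℝ | (∀ a, 0 ≤ p a) ∧ (∀ a ∉ S, p a = 0) ∧ ∑ a ∈ S, p a = 1} := by
    intro α S
    refine IsCompact.of_isClosed_subset
      (isCompact_univ_pi fun _ : α => isCompact_Icc (a := (0 : ℝ)) (b := 1)) ?_ ?_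
    · simp only [Set.ofPred_and, Set.ofPred_forall]
      refine IsClosed.inter (isClosed_iInter fun a => ?_) (IsClosed.inter
        (isClosed_iInter fun a => isClosed_iInter fun _ => ?_) ?_)
      · exact isClosed_le continuous_const (continuous_apply a)
      · exact isClosed_eq (continuous_apply a) continuous_const
      · exact isClosed_eq (continuous_finsetSum _ fun a _ => continuous_apply a)
          continuous_const
    · intro p hp a _
      exact ⟨hp.1 a, Mixed.le_one ⟨p, hp⟩ a⟩
  obtain ⟨s₁⟩ := Mixed.nonempty (G.actA_nonempty x)
  obtain ⟨t₁⟩ := Mixed.nonempty (G.actB_nonempty x)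
  obtain ⟨t₀, ht₀, s₀, hs₀, h⟩ := Sion.exists_isSaddlePointOn
    (f := fun (t : G.B → ℝ) (s : G.A → ℝ) => G.stepExp x s t (fun _ _ => f))
    ⟨t₁.1, t₁.2⟩ (hconv (G.actB x)) (hcomp (G.actB x))
    (fun s _ => Continuous.lowerSemicontinuous (by unfold stepExp; fun_prop)
      |>.lowerSemicontinuousOn _)
    (fun s _ => ConvexOn.quasiconvexOn ⟨hconv _, fun p _ r _ c d _ _ _ => le_of_eq (by
      simp only [stepExp, Pi.add_apply, Pi.smul_apply, smul_eq_mul, Finset.mul_sum,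
        ← Finset.sum_add_distrib]
      refine Finset.sum_congr rfl fun a _ => Finset.sum_congr rfl fun b _ => ?_
      ring)⟩)
    (hconv (G.actA x)) ⟨s₁.1, s₁.2⟩ (hcomp (G.actA x))
    (fun t _ => Continuous.upperSemicontinuous (by unfold stepExp; fun_prop)
      |>.upperSemicontinuousOn _)
    (fun t _ => ConcaveOn.quasiconcaveOn ⟨hconv _, fun p _ r _ c d _ _ _ => le_of_eq (by
      simp only [stepExp, Pi.add_apply, Pi.smul_apply, smul_eq_mul, Finset.mul_sum,
        ← Finset.sum_add_distrib]
      refine Finset.sum_congr rfl fun a _ => Finset.sum_congr rfl fun b _ => ?_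
      ring)⟩)
  exact ⟨⟨s₀, hs₀⟩, ⟨t₀, ht₀⟩, fun s t => h t.1 t.2 s.1 s.2⟩

theorem exists_abs_oneShotPayoff_le (f : G.X → ℝ) (x : G.X) :
    ∃ C, ∀ s t, |G.oneShotPayoff f x s t| ≤ C := by
  refine ⟨∑ a ∈ G.actA x, ∑ b ∈ G.actB x, |∑' y, G.q x a b y * f y|, fun s t => ?_⟩
  refine (Finset.abs_sum_le_sum_abs _ _).trans (Finset.sum_le_sum fun a _ =>
    (Finset.abs_sum_le_sum_abs _ _).trans (Finset.sum_le_sum fun b _ => ?_))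
  rw [abs_mul, abs_of_nonneg (mul_nonneg (s.2.1 a) (t.2.1 b))]
  exact mul_le_of_le_one_left (abs_nonneg _)
    (mul_le_one₀ (s.le_one a) (t.2.1 b) (t.le_one b))

end OneStep

section Recursion

variable {G : StocGame}

/-- The continuation of a strategy of player 1 after the first stage `(x, a, b)`. -/
def Strategy1.shift (σ : Strategy1 G) (x : G.X) (a : G.A) (b : G.B) : Strategy1 G where
  play h := σ.play ((x, a, b) :: h)
  nonneg _ := σ.nonneg _
  supp _ := σ.supp _
  sum_one _ := σ.sum_one _

/-- The continuation of a strategy of player 2 after the first stage `(x, a, b)`. -/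
def Strategy2.shift (τ : Strategy2 G) (x : G.X) (a : G.A) (b : G.B) : Strategy2 G where
  play h := τ.play ((x, a, b) :: h)
  nonneg _ := τ.nonneg _
  supp _ := τ.supp _
  sum_one _ := τ.sum_one _

/-- The first state of a past history `h` followed by the current state `z`. -/
def firstState : List (G.X × G.A × G.B) → G.X → G.X
  | [], z => z
  | e :: _, _ => e.1

/-- The strategy of player 1 playing `s` at the first stage, and then `κ a b y` if the first
actions are `a`, `b` and the second state is `y`. -/
def Strategy1.glue (s : ∀ z, Mixed (G.actA z)) (κ : G.A → G.B → G.X → Strategy1 G) :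
    Strategy1 G where
  play
    | [], z => (s z).1
    | (_, a, b) :: h, z => (κ a b (firstState h z)).play h z
  nonneg
    | [], z => (s z).2.1
    | (_, _, _) :: h, z => (κ _ _ _).nonneg h z
  supp
    | [], z => (s z).2.2.1
    | (_, _, _) :: h, z => (κ _ _ _).supp h z
  sum_one
    | [], z => (s z).2.2.2
    | (_, _, _) :: h, z => (κ _ _ _).sum_one h z

/-- The strategy of player 2 playing `t` at the first stage, and then `κ a b y` if the first
actions are `a`, `b` and the second state is `y`. -/
def Strategy2.glue (t : ∀ z, Mixed (G.actB z)) (κ : G.A → G.B → G.X → Strategy2 G) :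
    Strategy2 G where
  play
    | [], z => (t z).1
    | (_, a, b) :: h, z => (κ a b (firstState h z)).play h z
  nonneg
    | [], z => (t z).2.1
    | (_, _, _) :: h, z => (κ _ _ _).nonneg h z
  supp
    | [], z => (t z).2.2.1
    | (_, _, _) :: h, z => (κ _ _ _).supp h z
  sum_one
    | [], z => (t z).2.2.2
    | (_, _, _) :: h, z => (κ _ _ _).sum_one h z

instance : Nonempty (Strategy1 G) := by
  let p := fun x : G.X => Classical.choice (Mixed.nonempty (G.actA_nonempty x))
  exact ⟨⟨fun _ x => (p x).1, fun _ x => (p x).2.1, fun _ x => (p x).2.2.1,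
    fun _ x => (p x).2.2.2⟩⟩

instance : Nonempty (Strategy2 G) := by
  let p := fun x : G.X => Classical.choice (Mixed.nonempty (G.actB_nonempty x))
  exact ⟨⟨fun _ x => (p x).1, fun _ x => (p x).2.1, fun _ x => (p x).2.2.1,
    fun _ x => (p x).2.2.2⟩⟩

theorem histProbAux_append_singleton (x₁ : G.X) (σ : Strategy1 G) (τ : Strategy2 G)
    (x : G.X) (a : G.A) (b : G.B) (l : List (G.X × G.A × G.B)) (z : G.X) :
    G.histProbAux x₁ σ τ (l ++ [(x, a, b)]) z =
      if x = x₁ then σ.play [] x a * τ.play [] x b *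
        ∑' y, G.q x a b y * G.histProbAux y (σ.shift x a b) (τ.shift x a b) l z
      else 0 := by
  induction l generalizing z with
  | nil => by_cases h : x = x₁ <;> simp [histProbAux, h]
  | cons e l ih =>
    obtain ⟨y', a', b'⟩ := e
    simp only [List.cons_append, histProbAux, ih, List.reverse_append, List.reverse_cons,
      List.reverse_nil, List.nil_append, Strategy1.shift, Strategy2.shift]
    split_ifs with h
    · simp only [← mul_assoc, tsum_mul_right]
    · simp

theorem histProb_cons (x₁ : G.X) (σ : Strategy1 G) (τ : Strategy2 G)
    (x : G.X) (a : G.A) (b : G.B) (h : List (G.X × G.A × G.B)) (z : G.X) :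
    G.histProb x₁ σ τ ((x, a, b) :: h) z =
      if x = x₁ then σ.play [] x a * τ.play [] x b *
        ∑' y, G.q x a b y * G.histProb y (σ.shift x a b) (τ.shift x a b) h z
      else 0 := by
  simp only [histProb, List.reverse_cons, histProbAux_append_singleton]

variable (G) in
/-- Expectation of `F` at the history of the first `n` stages, computed recursively. -/
def histExp : ℕ → G.X → Strategy1 G → Strategy2 G → (List (G.X × G.A × G.B) → G.X → ℝ) → ℝ
  | 0, x, _, _, F => F [] x
  | n + 1, x, σ, τ, F => G.stepExp x (σ.play [] x) (τ.play [] x) fun a b y =>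
      histExp n y (σ.shift x a b) (τ.shift x a b) fun h z => F ((x, a, b) :: h) z

/-- Transport of `K` along the injection prepending `e` to the past history, extended by zero. -/
def consExtend (e : G.X × G.A × G.B) (K : List (G.X × G.A × G.B) × G.X → ℝ) :
    List (G.X × G.A × G.B) × G.X → ℝ
  | ([], _) => 0
  | (e' :: h, z) => if e' = e then K (h, z) else 0

theorem hasSum_consExtend (e : G.X × G.A × G.B) {K : List (G.X × G.A × G.B) × G.X → ℝ} {c : ℝ}
    (hK : HasSum K c) : HasSum (consExtend e K) c := by
  have hinj : Function.Injective
      (fun hx : List (G.X × G.A × G.B) × G.X => (e :: hx.1, hx.2)) := by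
    rintro ⟨h, z⟩ ⟨h', z'⟩ hh
    simpa using hh
  refine (hinj.hasSum_iff ?_).1 ?_
  · rintro ⟨_ | ⟨e', h⟩, z⟩ hx
    · rfl
    · refine if_neg fun he => hx ⟨(h, z), by rw [he]⟩
  · convert! hK using 1
    ext hx
    exact if_pos rfl

theorem hasSum_histExp (n : ℕ) (x : G.X) (σ : Strategy1 G) (τ : Strategy2 G)
    (F : List (G.X × G.A × G.B) → G.X → ℝ) :
    HasSum (fun hx : List (G.X × G.A × G.B) × G.X =>
      if hx.1.length = n then G.histProb x σ τ hx.1 hx.2 * F hx.1 hx.2 else 0)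
      (G.histExp n x σ τ F) := by
  induction n generalizing x σ τ F with
  | zero =>
    have h := hasSum_single (f := fun hx : List (G.X × G.A × G.B) × G.X =>
      if hx.1.length = 0 then G.histProb x σ τ hx.1 hx.2 * F hx.1 hx.2 else 0) ([], x) (by
        rintro ⟨_ | ⟨e, h⟩, z⟩ hz
        · have hz' : z ≠ x := fun h => hz (by rw [h])
          simp [histProb, histProbAux, hz']
        · simp)
    simpa [histProb, histProbAux, histExp] using h
  | succ n ih =>
    simp only [histExp, stepExp, tsum_q_mul_eq_sum]
    have h := hasSum_sum (s := G.actA x) fun a _ => hasSum_sum (s := G.actB x) fun b _ =>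
      (hasSum_sum (s := (G.q_finsupp x a b).toFinset) fun y _ =>
        (hasSum_consExtend (x, a, b) (ih y (σ.shift x a b) (τ.shift x a b)
          fun h z => F ((x, a, b) :: h) z)).mul_left (G.q x a b y)).mul_left
        (σ.play [] x a * τ.play [] x b)
    convert! h using 1
    ext ⟨_ | ⟨⟨x', a', b'⟩, l⟩, z⟩
    · simp [consExtend]
    · simp only [consExtend, List.length_cons, Nat.add_right_cancel_iff, Prod.mk.injEq,
        histProb_cons, tsum_q_mul_eq_sum]
      by_cases hl : l.length = n
      · by_cases hx : x' = x
        · subst hx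
          simp only [hl, if_true, true_and]
          rw [Finset.sum_eq_single a', Finset.sum_eq_single b']
          · simp only [and_self, if_true, Finset.sum_mul, Finset.mul_sum]
            exact Finset.sum_congr rfl fun y _ => by ring
          · intro b _ hb
            simp [hb.symm]
          · intro hb
            simp [τ.supp [] x' b' hb]
          · intro a _ ha
            simp [ha.symm]
          · intro ha
            simp [σ.supp [] x' a' ha]
        · simp [hx]
      · simp [hl]

variable (G) in
/-- Expected payoff at state `z` after the past history `h`. -/
def currentPayoff (σ : Strategy1 G) (τ : Strategy2 G) (h : List (G.X × G.A × G.B)) (z : G.X) :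
    ℝ :=
  ∑ a ∈ G.actA z, ∑ b ∈ G.actB z, σ.play h z a * τ.play h z b * G.g z a b

theorem stagePayoff_eq_histExp (x : G.X) (σ : Strategy1 G) (τ : Strategy2 G) (n : ℕ) :
    G.stagePayoff x σ τ (n + 1) = G.histExp n x σ τ (G.currentPayoff σ τ) := by
  rw [← (hasSum_histExp n x σ τ (G.currentPayoff σ τ)).tsum_eq]
  simp only [stagePayoff, Nat.add_right_cancel_iff, currentPayoff]

theorem stagePayoff_one (x : G.X) (σ : Strategy1 G) (τ : Strategy2 G) :
    G.stagePayoff x σ τ 1 = G.currentPayoff σ τ [] x :=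
  stagePayoff_eq_histExp x σ τ 0

theorem stagePayoff_add_two (x : G.X) (σ : Strategy1 G) (τ : Strategy2 G) (n : ℕ) :
    G.stagePayoff x σ τ (n + 2) = G.stepExp x (σ.play [] x) (τ.play [] x) fun a b y =>
      G.stagePayoff y (σ.shift x a b) (τ.shift x a b) (n + 1) := by
  simp only [stagePayoff_eq_histExp]
  rfl

theorem abs_stagePayoff_le (x : G.X) (σ : Strategy1 G) (τ : Strategy2 G) (n : ℕ) :
    |G.stagePayoff x σ τ (n + 1)| ≤ 1 := by
  induction n generalizing x σ τ with
  | zero =>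
    rw [zero_add, stagePayoff_one, currentPayoff]
    calc _ ≤ ∑ a ∈ G.actA x, ∑ b ∈ G.actB x, σ.play [] x a * τ.play [] x b := by
          refine (Finset.abs_sum_le_sum_abs _ _).trans (Finset.sum_le_sum fun a _ =>
            (Finset.abs_sum_le_sum_abs _ _).trans (Finset.sum_le_sum fun b _ => ?_))
          have h := mul_nonneg (σ.nonneg [] x a) (τ.nonneg [] x b)
          rw [abs_mul, abs_of_nonneg h]
          exact mul_le_of_le_one_right h (G.g_bdd x a b)
      _ = 1 := by simp only [← Finset.mul_sum, τ.sum_one, mul_one, σ.sum_one]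
  | succ n ih =>
    rw [stagePayoff_add_two, abs_le]
    have hc := stepExp_const x (σ.sum_one [] x) (τ.sum_one [] x)
    constructor
    · rw [← hc (-1)]
      exact stepExp_mono (σ.nonneg _ _) (τ.nonneg _ _) fun a b y => (abs_le.1 (ih _ _ _)).1
    · rw [← hc 1]
      exact stepExp_mono (σ.nonneg _ _) (τ.nonneg _ _) fun a b y => (abs_le.1 (ih _ _ _)).2

theorem stagePayoff_congr {x : G.X} {σ σ' : Strategy1 G} {τ τ' : Strategy2 G}
    (hσ : σ.play [] x = σ'.play [] x) (hτ : τ.play [] x = τ'.play [] x)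
    (hσs : ∀ a b, σ.shift x a b = σ'.shift x a b) (hτs : ∀ a b, τ.shift x a b = τ'.shift x a b)
    (n : ℕ) : G.stagePayoff x σ τ (n + 1) = G.stagePayoff x σ' τ' (n + 1) := by
  cases n with
  | zero => simp only [zero_add, stagePayoff_one, currentPayoff, hσ, hτ]
  | succ n => simp only [stagePayoff_add_two, hσ, hτ, hσs, hτs]

variable (G) in
/-- Expected total payoff over the `n` first stages. -/
def totalPayoff (n : ℕ) (x : G.X) (σ : Strategy1 G) (τ : Strategy2 G) : ℝ :=
  ∑ t ∈ Finset.range n, G.stagePayoff x σ τ (t + 1)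

theorem avgPayoff_eq (x : G.X) (σ : Strategy1 G) (τ : Strategy2 G) (n : ℕ) :
    G.avgPayoff x σ τ n = (n : ℝ)⁻¹ * G.totalPayoff n x σ τ := by
  rw [avgPayoff, totalPayoff, Finset.range_eq_Ico, Finset.sum_Ico_add' (G.stagePayoff x σ τ) 0 n 1]
  rfl

theorem abs_totalPayoff_le (n : ℕ) (x : G.X) (σ : Strategy1 G) (τ : Strategy2 G) :
    |G.totalPayoff n x σ τ| ≤ n := by
  refine (Finset.abs_sum_le_sum_abs _ _).trans ((Finset.sum_le_sum fun t _ =>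
    abs_stagePayoff_le x σ τ t).trans_eq ?_)
  simp

theorem totalPayoff_succ (n : ℕ) (x : G.X) (σ : Strategy1 G) (τ : Strategy2 G) :
    G.totalPayoff (n + 1) x σ τ = G.currentPayoff σ τ [] x +
      G.stepExp x (σ.play [] x) (τ.play [] x) fun a b y =>
        G.totalPayoff n y (σ.shift x a b) (τ.shift x a b) := by
  unfold totalPayoff
  rw [Finset.sum_range_succ', stepExp_sum, zero_add, stagePayoff_one, add_comm]
  simp only [stagePayoff_add_two, add_assoc, Nat.reduceAdd]

theorem totalPayoff_shift_glue_left (n : ℕ) (x : G.X) (s : ∀ z, Mixed (G.actA z))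
    (κ : G.A → G.B → G.X → Strategy1 G) (a : G.A) (b : G.B) (y : G.X) (τ : Strategy2 G) :
    G.totalPayoff n y ((Strategy1.glue s κ).shift x a b) τ = G.totalPayoff n y (κ a b y) τ := by
  refine Finset.sum_congr rfl fun _ _ => stagePayoff_congr ?_ ?_ ?_ ?_ _ <;> intros <;> rfl

theorem totalPayoff_shift_glue_right (n : ℕ) (x : G.X) (t : ∀ z, Mixed (G.actB z))
    (κ : G.A → G.B → G.X → Strategy2 G) (a : G.A) (b : G.B) (y : G.X) (σ : Strategy1 G) :
    G.totalPayoff n y σ ((Strategy2.glue t κ).shift x a b) = G.totalPayoff n y σ (κ a b y) := by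
  refine Finset.sum_congr rfl fun _ _ => stagePayoff_congr ?_ ?_ ?_ ?_ _ <;> intros <;> rfl

end Recursion

section Maxmin

variable {ι κ : Type*} {P Q : ι → κ → ℝ} {C c : ℝ}

theorem bddBelow_range_of_abs_le (hP : ∀ i k, |P i k| ≤ C) (i : ι) :
    BddBelow (Set.range (P i)) :=
  ⟨-C, by rintro _ ⟨k, rfl⟩; exact (abs_le.1 (hP i k)).1⟩

theorem bddAbove_range_iInf_of_abs_le [Nonempty κ] (hP : ∀ i k, |P i k| ≤ C) :
    BddAbove (Set.range fun i => ⨅ k, P i k) := by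
  refine ⟨C, ?_⟩
  rintro _ ⟨i, rfl⟩
  obtain ⟨k⟩ := ‹Nonempty κ›
  exact ciInf_le_of_le (bddBelow_range_of_abs_le hP i) k (abs_le.1 (hP i k)).2

theorem le_iSup_iInf_of_forall_le [Nonempty κ] (hP : ∀ i k, |P i k| ≤ C) (i : ι)
    (h : ∀ k, c ≤ P i k) : c ≤ ⨆ i, ⨅ k, P i k :=
  le_ciSup_of_le (bddAbove_range_iInf_of_abs_le hP) i (le_ciInf h)

theorem iSup_iInf_le_of_forall_exists_le [Nonempty ι] (hP : ∀ i k, |P i k| ≤ C)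
    (h : ∀ i, ∃ k, P i k ≤ c) : ⨆ i, ⨅ k, P i k ≤ c :=
  ciSup_le fun i => (h i).elim fun k hk => ciInf_le_of_le (bddBelow_range_of_abs_le hP i) k hk

theorem exists_forall_iSup_iInf_sub_le [Nonempty ι] (hP : ∀ i k, |P i k| ≤ C) {ε : ℝ}
    (hε : 0 < ε) : ∃ i, ∀ k, (⨆ i, ⨅ k, P i k) - ε ≤ P i k := by
  obtain ⟨i, hi⟩ := exists_lt_of_lt_ciSup (sub_lt_self (⨆ i, ⨅ k, P i k) hε)
  exact ⟨i, fun k => hi.le.trans (ciInf_le (bddBelow_range_of_abs_le hP i) k)⟩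

theorem exists_le_iSup_iInf_add [Nonempty κ] (hP : ∀ i k, |P i k| ≤ C) {ε : ℝ}
    (hε : 0 < ε) (i : ι) : ∃ k, P i k ≤ (⨆ i, ⨅ k, P i k) + ε := by
  obtain ⟨k, hk⟩ := exists_lt_of_ciInf_lt (lt_add_of_pos_right (⨅ k, P i k) hε)
  have h := le_ciSup (bddAbove_range_iInf_of_abs_le hP) i
  exact ⟨k, hk.le.trans (by gcongr)⟩

theorem iSup_iInf_le_iSup_iInf_add [Nonempty ι] [Nonempty κ] (hP : ∀ i k, |P i k| ≤ C)
    (hQ : ∀ i k, |Q i k| ≤ C) (h : ∀ i k, P i k ≤ Q i k + c) :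
    ⨆ i, ⨅ k, P i k ≤ (⨆ i, ⨅ k, Q i k) + c := by
  refine le_of_forall_pos_le_add fun ε hε => iSup_iInf_le_of_forall_exists_le hP fun i => ?_
  obtain ⟨k, hk⟩ := exists_le_iSup_iInf_add hQ hε i
  exact ⟨k, by linarith [h i k]⟩

end Maxmin

section TotalValue

variable {G : StocGame}

variable (G) in
/-- The maxmin of the total payoff over the `n` first stages. -/
def totalValue (n : ℕ) (x : G.X) : ℝ :=
  ⨆ σ : Strategy1 G, ⨅ τ : Strategy2 G, G.totalPayoff n x σ τ

theorem nValue_eq (n : ℕ) (x : G.X) : G.nValue n x = (n : ℝ)⁻¹ * G.totalValue n x := by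
  have hn : (0 : ℝ) ≤ (n : ℝ)⁻¹ := by positivity
  simp only [nValue, totalValue, avgPayoff_eq, Real.mul_iSup_of_nonneg hn,
    Real.mul_iInf_of_nonneg hn]

theorem abs_totalValue_succ_sub_le (n : ℕ) (x : G.X) :
    |G.totalValue (n + 1) x - G.totalValue n x| ≤ 1 := by
  have hsucc : ∀ σ τ, |G.totalPayoff (n + 1) x σ τ| ≤ (n : ℝ) + 1 := fun σ τ => by
    exact_mod_cast abs_totalPayoff_le (n + 1) x σ τ
  have hn : ∀ σ τ, |G.totalPayoff n x σ τ| ≤ (n : ℝ) + 1 := fun σ τ =>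
    (abs_totalPayoff_le n x σ τ).trans (by linarith)
  have hstep : ∀ σ τ, |G.totalPayoff (n + 1) x σ τ - G.totalPayoff n x σ τ| ≤ 1 := fun σ τ => by
    rw [totalPayoff, Finset.sum_range_succ, totalPayoff, add_sub_cancel_left]
    exact abs_stagePayoff_le x σ τ n
  have h₁ : G.totalValue (n + 1) x ≤ G.totalValue n x + 1 :=
    iSup_iInf_le_iSup_iInf_add hsucc hn fun σ τ => by linarith [(abs_le.1 (hstep σ τ)).2]
  have h₂ : G.totalValue n x ≤ G.totalValue (n + 1) x + 1 :=
    iSup_iInf_le_iSup_iInf_add hn hsucc fun σ τ => by linarith [(abs_le.1 (hstep σ τ)).1]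
  exact abs_le.2 ⟨by linarith, by linarith⟩

theorem le_totalValue_succ {n : ℕ} {x : G.X} (hg : ∀ a b, G.g x a b = 0)
    (s : Mixed (G.actA x)) {c : ℝ} (h : ∀ t, c ≤ G.oneShotPayoff (G.totalValue n) x s t) :
    c ≤ G.totalValue (n + 1) x := by
  refine le_of_forall_pos_le_add fun ε hε => ?_
  rw [← sub_le_iff_le_add]
  choose κ hκ using fun y : G.X =>
    exists_forall_iSup_iInf_sub_le (abs_totalPayoff_le n y) hε
  let s' : ∀ z, Mixed (G.actA z) := Function.update
    (fun z => Classical.choice (Mixed.nonempty (G.actA_nonempty z))) x s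
  have hs' : s' x = s := Function.update_self ..
  refine le_iSup_iInf_of_forall_le (abs_totalPayoff_le (n + 1) x)
    (Strategy1.glue s' fun _ _ y => κ y) fun τ => ?_
  rw [totalPayoff_succ]
  simp only [currentPayoff, hg, mul_zero, Finset.sum_const_zero, zero_add,
    totalPayoff_shift_glue_left]
  let t : Mixed (G.actB x) := ⟨τ.play [] x, τ.nonneg [] x, τ.supp [] x, τ.sum_one [] x⟩
  calc c - ε ≤ G.oneShotPayoff (G.totalValue n) x s t + -ε := by linarith [h t]
    _ = G.stepExp x s.1 t.1 fun _ _ y => G.totalValue n y + -ε :=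
      (stepExp_add_const x s.2.2.2 t.2.2.2 _ _).symm
    _ ≤ G.stepExp x s.1 t.1 fun a b y => G.totalPayoff n y (κ y) (τ.shift x a b) :=
      stepExp_mono s.2.1 t.2.1 fun a b y => hκ y _
    _ = _ := by rw [← hs']; rfl

theorem totalValue_succ_le {n : ℕ} {x : G.X} (hg : ∀ a b, G.g x a b = 0)
    (t : Mixed (G.actB x)) {c : ℝ} (h : ∀ s, G.oneShotPayoff (G.totalValue n) x s t ≤ c) :
    G.totalValue (n + 1) x ≤ c := by
  refine le_of_forall_pos_le_add fun ε hε =>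
    iSup_iInf_le_of_forall_exists_le (abs_totalPayoff_le (n + 1) x) fun σ => ?_
  choose κ hκ using fun (a : G.A) (b : G.B) (y : G.X) =>
    exists_le_iSup_iInf_add (abs_totalPayoff_le n y) hε (σ.shift x a b)
  let t' : ∀ z, Mixed (G.actB z) := Function.update
    (fun z => Classical.choice (Mixed.nonempty (G.actB_nonempty z))) x t
  have ht' : t' x = t := Function.update_self ..
  refine ⟨Strategy2.glue t' κ, ?_⟩
  rw [totalPayoff_succ]
  simp only [currentPayoff, hg, mul_zero, Finset.sum_const_zero, zero_add,
    totalPayoff_shift_glue_right]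
  let s : Mixed (G.actA x) := ⟨σ.play [] x, σ.nonneg [] x, σ.supp [] x, σ.sum_one [] x⟩
  calc _ = G.stepExp x s.1 t.1 fun a b y => G.totalPayoff n y (σ.shift x a b) (κ a b y) := by
        rw [← ht']; rfl
    _ ≤ G.stepExp x s.1 t.1 fun _ _ y => G.totalValue n y + ε :=
      stepExp_mono s.2.1 t.2.1 fun a b y => hκ a b y
    _ = G.oneShotPayoff (G.totalValue n) x s t + ε :=
      stepExp_add_const x s.2.2.2 t.2.2.2 _ _
    _ ≤ c + ε := by linarith [h s]

/-- If `f` is uniformly close to the value of the `n`-stage game, then at a state with zero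
payoff the value of the one-shot game `G^f` is close to `f`. -/
theorem abs_saddleValue_sub_le {f : G.X → ℝ} {x : G.X} (hg : ∀ a b, G.g x a b = 0)
    {s₀ : Mixed (G.actA x)} {t₀ : Mixed (G.actB x)}
    (hsad : ∀ s t, G.oneShotPayoff f x s t₀ ≤ G.oneShotPayoff f x s₀ t)
    {n : ℕ} (hn : 1 ≤ n) {ε : ℝ} (hε : ∀ y, |f y - G.nValue n y| ≤ ε) :
    |G.oneShotPayoff f x s₀ t₀ - f x| ≤ 2 * ε + (n : ℝ)⁻¹ := by
  have hn' : (0 : ℝ) < n := by exact_mod_cast hn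
  have htot : ∀ y, G.totalValue n y = n * G.nValue n y := fun y => by
    rw [nValue_eq, mul_inv_cancel_left₀ hn'.ne']
  have hE : ∀ s t, G.oneShotPayoff (G.totalValue n) x s t =
      n * G.oneShotPayoff (G.nValue n) x s t := fun s t => by
    rw [funext htot]
    exact stepExp_const_mul x s.1 t.1 n _
  have hlow : ∀ s t, G.oneShotPayoff f x s t + -ε ≤ G.oneShotPayoff (G.nValue n) x s t :=
    fun s t => (stepExp_add_const x s.2.2.2 t.2.2.2 (fun _ _ => f) (-ε)).ge.trans
      (stepExp_mono s.2.1 t.2.1 fun _ _ y => by linarith [(abs_le.1 (hε y)).2])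
  have hupp : ∀ s t, G.oneShotPayoff (G.nValue n) x s t ≤ G.oneShotPayoff f x s t + ε :=
    fun s t => (stepExp_mono s.2.1 t.2.1 fun _ _ y => by linarith [(abs_le.1 (hε y)).1]).trans
      (stepExp_add_const x s.2.2.2 t.2.2.2 (fun _ _ => f) ε).le
  set v := G.oneShotPayoff f x s₀ t₀ with hv
  have h₁ : n * (v - ε) ≤ G.totalValue (n + 1) x := le_totalValue_succ hg s₀ fun t => by
    rw [hE]
    gcongr
    linarith [hlow s₀ t, hsad s₀ t]
  have h₂ : G.totalValue (n + 1) x ≤ n * (v + ε) := totalValue_succ_le hg t₀ fun s => by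
    rw [hE]
    gcongr
    linarith [hupp s t₀, hsad s t₀]
  have h₃ := abs_le.1 (abs_totalValue_succ_sub_le n x)
  rw [htot x] at h₃
  have h₄ := abs_le.1 (hε x)
  have hinv : n * (n : ℝ)⁻¹ = 1 := mul_inv_cancel₀ hn'.ne'
  have h₅ : v - ε - G.nValue n x ≤ (n : ℝ)⁻¹ :=
    le_of_mul_le_mul_left (by linarith [h₃.2]) hn'
  have h₆ : G.nValue n x - v - ε ≤ (n : ℝ)⁻¹ :=
    le_of_mul_le_mul_left (by linarith [h₃.1]) hn'
  exact abs_le.2 ⟨by linarith, by linarith⟩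

theorem oneShotPayoff_of_trapping {f : G.X → ℝ} {x : G.X} (hq : ∀ a b, G.q x a b x = 1)
    (s : Mixed (G.actA x)) (t : Mixed (G.actB x)) : G.oneShotPayoff f x s t = f x := by
  rw [← stepExp_const x s.2.2.2 t.2.2.2 (f x)]
  refine Finset.sum_congr rfl fun a _ => Finset.sum_congr rfl fun b _ => ?_
  congr 1
  refine tsum_congr fun y => ?_
  by_cases hy : y = x
  · rw [hy]
  · have hsum : Summable (G.q x a b) := summable_of_hasFiniteSupport (G.q_finsupp x a b)
    have h := hsum.sum_le_tsum {y, x} fun z _ => G.q_nonneg x a b z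
    rw [G.q_sum, Finset.sum_pair hy, hq] at h
    have h0 : G.q x a b y = 0 := le_antisymm (by linarith) (G.q_nonneg x a b y)
    rw [h0, zero_mul, zero_mul]

end TotalValue

end StocGame

/-- Let `Γ` be a recursive game (countable state space) with
`{v_n : n ≥ 1}` totally bounded for the uniform norm, and let `f` be a limit point of
`(v_n)` for the uniform norm. Then for every state `x₁` the one-shot game `G^f` at
`x₁` has a value, equal to `f(x₁)`. -/
theorem oneShot_game_value_of_limit_point
    (G : RecGame) (hcount : Countable G.X)
    (htb : G.toStocGame.TotallyBoundedValues)
    (f : G.X → ℝ)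
    (hf : ∃ φ : ℕ → ℕ, StrictMono φ ∧
      TendstoUniformly (fun k x => G.toStocGame.nValue (φ k) x) f Filter.atTop) :
    ∀ x₁ : G.X,
      (⨆ s : StocGame.Mixed (G.actA x₁), ⨅ t : StocGame.Mixed (G.actB x₁),
        G.toStocGame.oneShotPayoff f x₁ s t) = f x₁ ∧
      (⨅ t : StocGame.Mixed (G.actB x₁), ⨆ s : StocGame.Mixed (G.actA x₁),
        G.toStocGame.oneShotPayoff f x₁ s t) = f x₁ := by
  intro x₁
  obtain ⟨s₀, t₀, hsad⟩ := StocGame.exists_saddlePoint_oneShotPayoff f x₁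
  have hval : G.toStocGame.oneShotPayoff f x₁ s₀ t₀ = f x₁ := by
    by_cases hx : G.absorbing x₁
    · exact StocGame.oneShotPayoff_of_trapping (fun a b => G.absorbing_q x₁ a b hx) s₀ t₀
    · obtain ⟨φ, hφ, hlim⟩ := hf
      refine eq_of_abs_sub_le_all fun δ hδ => ?_
      have hε : 0 < δ / 3 := by positivity
      have hinv : ∀ᶠ k in atTop, ((φ k : ℕ) : ℝ)⁻¹ < δ / 3 :=
        (tendsto_inv_atTop_nhds_zero_nat.comp hφ.tendsto_atTop).eventually_lt_const hε
      obtain ⟨k, hk, hk', hk1⟩ := ((Metric.tendstoUniformly_iff.1 hlim _ hε).and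
        (hinv.and (hφ.tendsto_atTop.eventually_ge_atTop 1))).exists
      have h := StocGame.abs_saddleValue_sub_le (fun a b => G.g_active x₁ a b hx) hsad hk1
        fun y => (Real.dist_eq _ _ ▸ hk y).le
      linarith
  obtain ⟨C, hC⟩ := StocGame.exists_abs_oneShotPayoff_le f x₁
  have : Nonempty (StocGame.Mixed (G.actA x₁)) := ⟨s₀⟩
  have : Nonempty (StocGame.Mixed (G.actB x₁)) := ⟨t₀⟩
  have habove : ∀ t, BddAbove (Set.range fun s => G.toStocGame.oneShotPayoff f x₁ s t) :=
    fun t => ⟨C, by rintro _ ⟨s, rfl⟩; exact (abs_le.1 (hC s t)).2⟩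
  rw [← hval]
  refine ⟨le_antisymm ?_ ?_, le_antisymm ?_ ?_⟩
  · exact StocGame.iSup_iInf_le_of_forall_exists_le hC fun s => ⟨t₀, hsad s t₀⟩
  · exact StocGame.le_iSup_iInf_of_forall_le hC s₀ fun t => hsad s₀ t
  · refine ciInf_le_of_le ⟨-C, ?_⟩ t₀ (ciSup_le fun s => hsad s t₀)
    rintro _ ⟨t, rfl⟩
    exact le_ciSup_of_le (habove t) s₀ (abs_le.1 (hC s₀ t)).1
  · exact le_ciInf fun t => le_ciSup_of_le (habove t) s₀ (hsad s₀ t)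
end
end

section
/- Let Γ be a two-player zero-sum stochastic game with finitely supported transitions and finite action sets at each state. Fix an initial state x₁ ∈ X and a strategy σ̂ ∈ Σ̂ of player 1 that depends on the history only through the sequence of states. Then for every strategy τ ∈ 𝒯 of player 2 there exists a strategy τ̂ ∈ 𝒯̂ (depending only on the sequence of states) such that for every t ≥ 1 and every sequence of states (x₁,…,x_t) ∈ X^t, P_{x₁,σ̂,τ̂}(x₁,…,x_t) = P_{x₁,σ̂,τ}(x₁,…,x_t); that is, the two strategy pairs induce the same law on the sequence of states. -/
open scoped Classical
open Filter

noncomputable section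

namespace StocGame

variable {G : StocGame}

/-- The finite set of feasible past histories, in reverse chronological order, whose
states are the given list. -/
def revHists : List G.X → Finset (List (G.X × G.A × G.B))
  | [] => {[]}
  | y :: l => (G.actA y ×ˢ G.actB y ×ˢ revHists l).image fun p => (y, p.1, p.2.1) :: p.2.2

theorem map_fst_of_mem_revHists {l : List G.X} {r : List (G.X × G.A × G.B)}
    (hr : r ∈ revHists l) : r.map Prod.fst = l := by
  induction l generalizing r with
  | nil => simp_all [revHists]
  | cons y l ih =>
    simp only [revHists, Finset.mem_image, Finset.mem_product] at hr
    obtain ⟨p, ⟨-, -, hp⟩, rfl⟩ := hr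
    simp [ih hp]

theorem sum_revHists_cons (y : G.X) (l : List G.X) (f : List (G.X × G.A × G.B) → ℝ) :
    ∑ r ∈ revHists (y :: l), f r =
      ∑ a ∈ G.actA y, ∑ b ∈ G.actB y, ∑ r ∈ revHists l, f ((y, a, b) :: r) := by
  rw [revHists, Finset.sum_image]
  · simp only [Finset.sum_product]
  · rintro ⟨a, b, r⟩ - ⟨a', b', r'⟩ - h
    simpa [and_assoc] using h

theorem histProbAux_nonneg (x₁ : G.X) (σ : Strategy1 G) (τ : Strategy2 G)
    (r : List (G.X × G.A × G.B)) (x : G.X) : 0 ≤ G.histProbAux x₁ σ τ r x := by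
  induction r generalizing x with
  | nil => unfold histProbAux; split_ifs <;> norm_num
  | cons p r ih =>
    exact mul_nonneg (mul_nonneg (mul_nonneg (ih _) (σ.nonneg _ _ _)) (τ.nonneg _ _ _))
      (G.q_nonneg _ _ _ _)

theorem mem_revHists_of_histProbAux_ne_zero {x₁ : G.X} {σ : Strategy1 G} {τ : Strategy2 G}
    {r : List (G.X × G.A × G.B)} {x : G.X} (h : G.histProbAux x₁ σ τ r x ≠ 0) :
    r ∈ revHists (r.map Prod.fst) := by
  induction r generalizing x with
  | nil => simp [revHists]
  | cons p r ih =>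
    obtain ⟨y, a, b⟩ := p
    simp only [histProbAux, mul_ne_zero_iff] at h
    obtain ⟨⟨⟨hr, ha⟩, hb⟩, -⟩ := h
    simp only [List.map_cons, revHists, Finset.mem_image, Finset.mem_product]
    exact ⟨(a, b, r), ⟨not_imp_comm.1 (σ.supp _ _ _) ha, not_imp_comm.1 (τ.supp _ _ _) hb,
      ih hr⟩, rfl⟩

/-- The probability of visiting the past states `l` (in reverse chronological order)
and then the current state `x`, as a finite sum over feasible histories. -/
def revStatesProb (x₁ : G.X) (σ : Strategy1 G) (τ : Strategy2 G) (l : List G.X) (x : G.X) : ℝ :=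
  ∑ r ∈ revHists l, G.histProbAux x₁ σ τ r x

theorem statesProb_nil (x₁ : G.X) (σ : Strategy1 G) (τ : Strategy2 G) :
    G.statesProb x₁ σ τ [] = 0 := by
  simp [statesProb, stateSeq]

theorem statesProb_reverse_append (x₁ : G.X) (σ : Strategy1 G) (τ : Strategy2 G)
    (l : List G.X) (x : G.X) :
    G.statesProb x₁ σ τ (l.reverse ++ [x]) = revStatesProb x₁ σ τ l x := by
  have hinj : Function.Injective
      fun r : List (G.X × G.A × G.B) => (r.reverse, x) := by
    intro r r' h
    simpa using h
  rw [statesProb, tsum_eq_sum (s := (revHists l).image fun r => (r.reverse, x)),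
    Finset.sum_image hinj.injOn, revStatesProb]
  · refine Finset.sum_congr rfl fun r hr => ?_
    simp [stateSeq, histProb, map_fst_of_mem_revHists hr]
  · rintro ⟨h, y⟩ hh
    refine ite_eq_right_iff.2 fun hs => ?_
    by_contra hne
    obtain ⟨h1, h2⟩ := List.append_inj' hs rfl
    obtain rfl : y = x := by simpa using h2
    have hm := mem_revHists_of_histProbAux_ne_zero hne
    rw [List.map_reverse, h1, List.reverse_reverse] at hm
    exact hh (Finset.mem_image.2 ⟨h.reverse, hm, by simp⟩)

/-- The conditional law of the action of player 2 given past states `l` (in reverse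
chronological order) and current state `x`; uniform if these states have probability zero. -/
def condPlay (x₁ : G.X) (σ : Strategy1 G) (τ : Strategy2 G) (l : List G.X) (x : G.X) (b : G.B) :
    ℝ :=
  if revStatesProb x₁ σ τ l x = 0 then
    if b ∈ G.actB x then ((G.actB x).card : ℝ)⁻¹ else 0
  else (∑ r ∈ revHists l, G.histProbAux x₁ σ τ r x * τ.play r.reverse x b) /
    revStatesProb x₁ σ τ l x

theorem revStatesProb_nonneg (x₁ : G.X) (σ : Strategy1 G) (τ : Strategy2 G) (l : List G.X)
    (x : G.X) : 0 ≤ revStatesProb x₁ σ τ l x :=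
  Finset.sum_nonneg fun _ _ => histProbAux_nonneg ..

theorem revStatesProb_mul_condPlay (x₁ : G.X) (σ : Strategy1 G) (τ : Strategy2 G)
    (l : List G.X) (x : G.X) (b : G.B) :
    revStatesProb x₁ σ τ l x * condPlay x₁ σ τ l x b =
      ∑ r ∈ revHists l, G.histProbAux x₁ σ τ r x * τ.play r.reverse x b := by
  by_cases h : revStatesProb x₁ σ τ l x = 0
  · have h' := (Finset.sum_eq_zero_iff_of_nonneg fun _ _ => histProbAux_nonneg ..).1 h
    rw [h, zero_mul, Finset.sum_eq_zero]
    intro r hr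
    rw [h' r hr, zero_mul]
  · rw [condPlay, if_neg h, mul_div_cancel₀ _ h]

/-- The strategy of player 2 which plays the conditional law of the action under `τ`
given the sequence of states. -/
def condStrategy (x₁ : G.X) (σ : Strategy1 G) (τ : Strategy2 G) : Strategy2 G where
  play h x b := condPlay x₁ σ τ (h.map Prod.fst).reverse x b
  nonneg h x b := by
    unfold condPlay
    split_ifs
    · positivity
    · exact le_rfl
    · exact div_nonneg (Finset.sum_nonneg fun _ _ =>
        mul_nonneg (histProbAux_nonneg ..) (τ.nonneg _ _ _)) (revStatesProb_nonneg ..)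
  supp h x b hb := by
    simp [condPlay, hb, τ.supp _ x b hb]
  sum_one h x := by
    by_cases h0 : revStatesProb x₁ σ τ (h.map Prod.fst).reverse x = 0
    · have hc : ((G.actB x).card : ℝ) ≠ 0 := by
        simpa using (G.actB_nonempty x).ne_empty
      simp only [condPlay, if_pos h0]
      rw [Finset.sum_congr rfl fun b hb => if_pos hb, Finset.sum_const, nsmul_eq_mul,
        mul_inv_cancel₀ hc]
    · apply mul_left_cancel₀ h0
      simp only [Finset.mul_sum, revStatesProb_mul_condPlay]
      rw [Finset.sum_comm, mul_one]
      simp [← Finset.mul_sum, τ.sum_one, revStatesProb]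

theorem revStatesProb_condStrategy (x₁ : G.X) {σ : Strategy1 G} (hσ : σ.stateDep)
    (τ : Strategy2 G) (l : List G.X) (x : G.X) :
    revStatesProb x₁ σ (condStrategy x₁ σ τ) l x = revStatesProb x₁ σ τ l x := by
  induction l generalizing x with
  | nil => simp [revStatesProb, revHists, histProbAux]
  | cons y l ih =>
    simp only [revStatesProb, sum_revHists_cons, histProbAux]
    refine Finset.sum_congr rfl fun a _ => Finset.sum_congr rfl fun b _ => ?_
    obtain ⟨c, hc⟩ : ∃ c, ∀ r ∈ revHists l, σ.play r.reverse y a = c := by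
      rcases (revHists l).eq_empty_or_nonempty with h | ⟨r₀, hr₀⟩
      · exact ⟨0, by simp [h]⟩
      · refine ⟨σ.play r₀.reverse y a, fun r hr => congrFun (hσ _ _ y ?_) a⟩
        simp [map_fst_of_mem_revHists hr, map_fst_of_mem_revHists hr₀]
    have key (τ' : Strategy2 G) :
        ∑ r ∈ revHists l, G.histProbAux x₁ σ τ' r y * σ.play r.reverse y a *
            τ'.play r.reverse y b * G.q y a b x =
          (∑ r ∈ revHists l, G.histProbAux x₁ σ τ' r y * τ'.play r.reverse y b) *
            (c * G.q y a b x) := by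
      rw [Finset.sum_mul]
      refine Finset.sum_congr rfl fun r hr => ?_
      rw [hc r hr]
      ring
    rw [key, key, ← revStatesProb_mul_condPlay x₁ σ τ, ← ih]
    congr 1
    rw [revStatesProb, Finset.sum_mul]
    refine Finset.sum_congr rfl fun r hr => ?_
    simp [condStrategy, map_fst_of_mem_revHists hr]

end StocGame

/-- In a two-player zero-sum stochastic game with finitely
supported transitions and finite action sets at each state, fix an initial state `x₁`
and a strategy `σ̂ ∈ Σ̂` of player 1 depending on the history only through the
sequence of states. Then for every strategy `τ` of player 2 there is a strategy
`τ̂ ∈ 𝒯̂` depending only on the sequence of states inducing the same law on the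
sequences of states: `P_{x₁,σ̂,τ̂}(x₁,…,x_t) = P_{x₁,σ̂,τ}(x₁,…,x_t)` for every `t`
and every sequence of states. -/
theorem exists_stateDep_reply_same_state_law
    (G : StocGame) (x₁ : G.X) (σ : G.Strategy1) (hσ : σ.stateDep) :
    ∀ τ : G.Strategy2, ∃ τhat : G.Strategy2, τhat.stateDep ∧
      ∀ s : List G.X, G.statesProb x₁ σ τhat s = G.statesProb x₁ σ τ s := by
  intro τ
  refine ⟨StocGame.condStrategy x₁ σ τ, fun h h' x hh => ?_, fun s => ?_⟩
  · simp only [StocGame.condStrategy, hh]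
  · rcases s.eq_nil_or_concat with rfl | ⟨l, x, rfl⟩
    · simp only [StocGame.statesProb_nil]
    · rw [List.concat_eq_append, ← l.reverse_reverse, StocGame.statesProb_reverse_append,
        StocGame.statesProb_reverse_append, StocGame.revStatesProb_condStrategy x₁ hσ]
end
end
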